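/- Let W₁, ..., W_L be real matrices with W_l of size d_l × d_{l-1}, forming a critical point of G(W) = ‖W_L⋯W₁ - √λ·Y‖_F² + λ·∑_{l=1}^L ‖W_l‖_F² (i.e., all partial gradients vanish). Then the balancedness condition W_l·W_lᵀ = W_{l+1}ᵀ·W_{l+1} holds for every l = 1, ..., L-1. -/

import Mathlib

open Matrix

/-- `chainProd d W j = W_{j-1} ⋯ W_0 : ℝ^{d 0} → ℝ^{d j}` (the product of the first `j`
layer matrices; empty product is the identity). -/
noncomputable def chainProd (d : ℕ → ℕ)
    (W : ∀ l : ℕ, Matrix (Fin (d (l + 1))) (Fin (d l)) ℝ) :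
    ∀ j : ℕ, Matrix (Fin (d j)) (Fin (d 0)) ℝ
  | 0 => (1 : Matrix (Fin (d 0)) (Fin (d 0)) ℝ)
  | j + 1 => W j * chainProd d W j

/-- `tchainProd d W s k = W_sᵀ W_{s+1}ᵀ ⋯ W_{s+k-1}ᵀ = (W_{s+k-1} ⋯ W_s)ᵀ`. -/
noncomputable def tchainProd (d : ℕ → ℕ)
    (W : ∀ l : ℕ, Matrix (Fin (d (l + 1))) (Fin (d l)) ℝ) (s : ℕ) :
    ∀ k : ℕ, Matrix (Fin (d s)) (Fin (d (s + k))) ℝ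
  | 0 => (1 : Matrix (Fin (d s)) (Fin (d s)) ℝ)
  | k + 1 => tchainProd d W s k * (W (s + k))ᵀ

theorem W_cast_aux (d : ℕ → ℕ)
    (W : ∀ l : ℕ, Matrix (Fin (d (l + 1))) (Fin (d l)) ℝ) (a b : ℕ) (h : a = b)
    (h1 : d (a + 1) = d (b + 1)) (h0 : d a = d b) :
    W a = (W b).submatrix (finCongr h1) (finCongr h0) := by
  subst h
  rfl

theorem tchain_aux (d : ℕ → ℕ)
    (W : ∀ l : ℕ, Matrix (Fin (d (l + 1))) (Fin (d l)) ℝ) (s : ℕ) :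
    ∀ (k : ℕ) (h : d (s + (k + 1)) = d (s + 1 + k)),
      tchainProd d W s (k + 1) =
        (W s)ᵀ * (tchainProd d W (s + 1) k).submatrix id (finCongr h)
  | 0, h => by
    change (1 : Matrix (Fin (d s)) (Fin (d s)) ℝ) * (W s)ᵀ =
      (W s)ᵀ * (1 : Matrix (Fin (d (s + 1))) (Fin (d (s + 1))) ℝ)
    rw [Matrix.one_mul, Matrix.mul_one]
  | k + 1, h => by
    have h0 : s + (k + 1) = s + 1 + k := by omega
    have ih := tchain_aux d W s k (congrArg d h0)
    rw [tchainProd, ih, W_cast_aux d W _ _ h0 h (congrArg d h0), Matrix.mul_assoc,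
      Matrix.transpose_submatrix, Matrix.submatrix_mul_equiv]
    rfl

theorem tchain_mul_aux (d : ℕ → ℕ)
    (W : ∀ l : ℕ, Matrix (Fin (d (l + 1))) (Fin (d l)) ℝ) (s k L : ℕ)
    (h : d L = d (s + (k + 1))) (h' : d L = d (s + 1 + k))
    (X : Matrix (Fin (d L)) (Fin (d 0)) ℝ) :
    tchainProd d W s (k + 1) * Matrix.reindex (finCongr h) (Equiv.refl (Fin (d 0))) X =
      (W s)ᵀ * (tchainProd d W (s + 1) k *
        Matrix.reindex (finCongr h') (Equiv.refl (Fin (d 0))) X) := by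
  have e : Matrix.reindex (finCongr h) (Equiv.refl (Fin (d 0))) X =
      (Matrix.reindex (finCongr h') (Equiv.refl (Fin (d 0))) X).submatrix
        (finCongr (h.symm.trans h')) id := rfl
  rw [tchain_aux d W s k (h.symm.trans h'), e, Matrix.mul_assoc, Matrix.submatrix_mul_equiv]
  rfl

/-- A critical point of `G(W) = ‖W_{L-1}⋯W_0 - √λ Y‖_F² + λ ∑ ‖W_l‖_F²` (in the sense that
all partial gradients `2 W_{L:l+1}ᵀ (W_{L:1} - √λ Y) W_{l-1:1}ᵀ + 2λ W_l` vanish)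
satisfies the balancedness condition `W_l W_lᵀ = W_{l+1}ᵀ W_{l+1}`. -/
theorem stmt_12 (L : ℕ) (hL : 2 ≤ L) (d : ℕ → ℕ) (lam : ℝ) (hlam : 0 < lam)
    (Y : Matrix (Fin (d L)) (Fin (d 0)) ℝ)
    (W : ∀ l : ℕ, Matrix (Fin (d (l + 1))) (Fin (d l)) ℝ)
    (hcrit : ∀ m k : ℕ, ∀ h : L = m + 1 + k,
      (2 : ℝ) • (tchainProd d W (m + 1) k *
          (Matrix.reindex (finCongr (congrArg d h)) (Equiv.refl (Fin (d 0)))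
            (chainProd d W L - Real.sqrt lam • Y)) *
          (chainProd d W m)ᵀ)
        + (2 * lam) • W m = 0) :
    ∀ l : ℕ, l + 1 < L → W l * (W l)ᵀ = (W (l + 1))ᵀ * W (l + 1) := by
  intro l hl
  obtain ⟨k, hk⟩ : ∃ k, L = l + 1 + 1 + k := ⟨L - (l + 2), by omega⟩
  have hk' : L = l + 1 + (k + 1) := by omega
  have A := hcrit l (k + 1) hk'
  have B := hcrit (l + 1) k hk
  rw [tchain_mul_aux d W (l + 1) k L _ (congrArg d hk)] at A
  generalize tchainProd d W (l + 1 + 1) k * _ = Z at A B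
  have A' := congrArg (fun M => M * (W l)ᵀ) A
  have B' := congrArg (fun M => (W (l + 1))ᵀ * M) B
  simp only [chainProd, Matrix.transpose_mul, Matrix.add_mul, Matrix.mul_add, Matrix.smul_mul,
    Matrix.mul_smul, Matrix.mul_assoc, Matrix.zero_mul, Matrix.mul_zero] at A' B'
  have hne : (2 * lam) ≠ 0 := by positivity
  exact smul_right_injective _ hne (add_left_cancel (A'.trans B'.symm))
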